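/- For the golden-ratio subshift, the Perron–Frobenius operator V_S maps each space X_n = W ⊗ span{1, h, …, hⁿ} into itself, where W = ℂ𝟙_{C[0]} ⊕ ℂ𝟙_{C[1]}, and in the basis 𝟙_{C[0]}, 𝟙_{C[1]}, …, 𝟙_{C[0]}hⁿ, 𝟙_{C[1]}hⁿ its matrix is block upper-triangular with 2×2 diagonal blocks Q_k = [[φ^{-k-1}, φ^{-k-2}],[φ^{-k}, 0]], k = 0, …, n. Consequently the eigenvalues of V_S restricted to X = W ⊗ ℂ[h] are exactly {φ^{-n} : n ≥ 0} ∪ {−φ^{-n-2} : n ≥ 0} (the eigenvalues of the matrices Q_n), and each eigenspace of V_S|_X is one-dimensional. -/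

import Mathlib

open MeasureTheory Filter
open scoped ENNReal

noncomputable section

/-- The golden ratio `φ = (1 + √5)/2`. -/
def goldphi : ℝ := (1 + Real.sqrt 5) / 2

/-- The stationary probability vector `π = (φ², 1)/(φ² + 1)`. -/
def gpi (i : Fin 2) : ℝ :=
  if i = 0 then goldphi ^ 2 / (goldphi ^ 2 + 1) else 1 / (goldphi ^ 2 + 1)

/-- The transition matrix `P = [[φ⁻¹, φ⁻²], [1, 0]]`. -/
def gP (i j : Fin 2) : ℝ :=
  if i = 0 then (if j = 0 then goldphi⁻¹ else goldphi⁻¹ ^ 2)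
  else (if j = 0 then 1 else 0)

/-- `μ` is the Markov measure of the golden-ratio subshift. -/
def IsGoldenMarkov (μ : Measure (ℕ → Fin 2)) : Prop :=
  ∀ (r : ℕ) (x : ℕ → Fin 2),
    μ {ω | ∀ k ≤ r, ω k = x k} =
      ENNReal.ofReal (gpi (x 0) * ∏ k ∈ Finset.range r, gP (x k) (x (k + 1)))

/-- The left shift `(Sω)_j = ω_{j+1}` (index `n` corresponds to `ω_{n+1}`). -/
def shift (ω : ℕ → Fin 2) : ℕ → Fin 2 := fun n => ω (n + 1)

/-- `h(ω) = ∑_{k≥1} ω_k φ^{-k}`. -/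
def hGold (ω : ℕ → Fin 2) : ℝ := ∑' k : ℕ, (ω k : ℝ) * goldphi⁻¹ ^ (k + 1)

/-- The indicator (as a `ℂ`-valued function) of the cylinder `C[j] = {ω : ω₁ = j}`. -/
def indC (j : Fin 2) (ω : ℕ → Fin 2) : ℂ := if ω 0 = j then 1 else 0

/-- Membership in `X_{n-1} = W ⊗ span{1, h, …, h^{n−1}}`, the span of `𝟙_{C[j]} h^k` for
`j = 0, 1` and `k < n` (so `InXlt μ 0 f` means `f = 0` and `InXlt μ (n+1) f` means `f ∈ X_n`). -/
def InXlt (μ : Measure (ℕ → Fin 2)) (n : ℕ) (f : Lp ℂ 2 μ) : Prop :=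
  ∃ c : Fin 2 → ℕ → ℂ,
    ⇑f =ᵐ[μ] fun ω => ∑ k ∈ Finset.range n, ∑ j : Fin 2, c j k * indC j ω * (hGold ω : ℂ) ^ k

section Triangular

variable {E : Type*} [AddCommGroup E] [Module ℂ E]

/-- The span of the first `m` terms of a sequence of vectors. -/
def initialSpan (u : ℕ → E) (m : ℕ) : Submodule ℂ E := Submodule.span ℂ (u '' Set.Iio m)

lemma initialSpan_mono (u : ℕ → E) : Monotone (initialSpan u) := fun _ _ h =>
  Submodule.span_mono (Set.image_mono (Set.Iio_subset_Iio h))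

lemma mem_initialSpan_of_lt (u : ℕ → E) {i m : ℕ} (h : i < m) : u i ∈ initialSpan u m :=
  Submodule.subset_span ⟨i, h, rfl⟩

lemma initialSpan_zero (u : ℕ → E) : initialSpan u 0 = ⊥ := by
  simp [initialSpan]

lemma exists_of_mem_initialSpan_succ {u : ℕ → E} {m : ℕ} {f : E}
    (hf : f ∈ initialSpan u (m + 1)) : ∃ c : ℂ, ∃ y ∈ initialSpan u m, f = c • u m + y := by
  have h : initialSpan u (m + 1) = Submodule.span ℂ (insert (u m) (u '' Set.Iio m)) := by
    rw [initialSpan, ← Set.image_insert_eq]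
    congr 2
    ext i
    simp only [Set.mem_Iio, Set.mem_insert_iff]
    omega
  rw [h, Submodule.mem_span_insert] at hf
  exact hf

variable {T : E →ₗ[ℂ] E} {u : ℕ → E} {l : ℕ → ℂ}

lemma map_mem_initialSpan (hT : ∀ m, T (u m) - l m • u m ∈ initialSpan u m) (m : ℕ) {f : E}
    (hf : f ∈ initialSpan u m) : T f ∈ initialSpan u m := by
  suffices initialSpan u m ≤ (initialSpan u m).comap T from this hf
  refine Submodule.span_le.2 ?_
  rintro _ ⟨i, hi, rfl⟩
  have h := (initialSpan u m).add_mem (initialSpan_mono u (le_of_lt hi) (hT i))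
    ((initialSpan u m).smul_mem (l i) (mem_initialSpan_of_lt u hi))
  simpa using h

/-- If `z` is not one of the first `m` diagonal entries, then `T - z` maps the span of the first
`m` vectors onto itself. -/
lemma exists_map_sub_smul_eq (hT : ∀ m, T (u m) - l m • u m ∈ initialSpan u m) {z : ℂ} (m : ℕ)
    (hz : ∀ i < m, l i ≠ z) {y : E} (hy : y ∈ initialSpan u m) :
    ∃ r ∈ initialSpan u m, T r - z • r = y := by
  induction m generalizing y with
  | zero =>
    rw [initialSpan_zero, Submodule.mem_bot] at hy
    exact ⟨0, Submodule.zero_mem _, by simp [hy]⟩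
  | succ m ih =>
    obtain ⟨c, y', hy', rfl⟩ := exists_of_mem_initialSpan_succ hy
    have hne : l m - z ≠ 0 := sub_ne_zero.2 (hz m m.lt_succ_self)
    set s := c / (l m - z) with hs
    have hc : c = s * (l m - z) := by rw [hs]; field_simp
    obtain ⟨r, hr, hr'⟩ := ih (fun i hi => hz i (by omega))
      (Submodule.sub_mem _ hy' (Submodule.smul_mem _ s (hT m)))
    refine ⟨s • u m + r, Submodule.add_mem _ (Submodule.smul_mem _ _
      (mem_initialSpan_of_lt u m.lt_succ_self)) (initialSpan_mono u m.le_succ hr), ?_⟩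
    have : T (s • u m + r) - z • (s • u m + r)
        = s • (T (u m) - l m • u m) + (T r - z • r) + (s * (l m - z)) • u m := by
      rw [map_add, map_smul]
      module
    rw [this, hr', hc]
    abel

lemma mem_initialSpan_of_map_eq_smul (hT : ∀ m, T (u m) - l m • u m ∈ initialSpan u m)
    {z : ℂ} {m : ℕ} (hz : l m ≠ z) {f : E} (hf : f ∈ initialSpan u (m + 1))
    (hfz : T f = z • f) : f ∈ initialSpan u m := by
  obtain ⟨c, y, hy, rfl⟩ := exists_of_mem_initialSpan_succ hf
  refine Submodule.add_mem _ ?_ hy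
  have h : (c * (l m - z)) • u m = z • y - T y - c • (T (u m) - l m • u m) := by
    rw [map_add, map_smul] at hfz
    rw [eq_sub_of_add_eq' hfz]
    module
  have h' : (c * (l m - z)) • u m ∈ initialSpan u m := by
    rw [h]
    exact Submodule.sub_mem _ (Submodule.sub_mem _ (Submodule.smul_mem _ _ hy)
      (map_mem_initialSpan hT m hy)) (Submodule.smul_mem _ _ (hT m))
  have hne : l m - z ≠ 0 := sub_ne_zero.2 hz
  have := Submodule.smul_mem _ (l m - z)⁻¹ h'
  rwa [smul_smul, mul_comm c, inv_mul_cancel_left₀ hne] at this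

lemma exists_diag_eq_of_map_eq_smul (hT : ∀ m, T (u m) - l m • u m ∈ initialSpan u m)
    {z : ℂ} (m : ℕ) {f : E} (hf : f ∈ initialSpan u m) (hf0 : f ≠ 0)
    (hfz : T f = z • f) : ∃ i < m, z = l i := by
  induction m with
  | zero => exact absurd (by simpa [initialSpan_zero] using hf) hf0
  | succ m ih =>
    by_cases hz : l m = z
    · exact ⟨m, m.lt_succ_self, hz.symm⟩
    · obtain ⟨i, hi, h⟩ := ih (mem_initialSpan_of_map_eq_smul hT hz hf hfz)
      exact ⟨i, by omega, h⟩

lemma exists_eq_smul_of_map_eq_smul (hT : ∀ m, T (u m) - l m • u m ∈ initialSpan u m)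
    (hl : Function.Injective l) {z : ℂ} (m : ℕ) {f g : E} (hf : f ∈ initialSpan u m)
    (hf0 : f ≠ 0) (hfz : T f = z • f) (hg : g ∈ initialSpan u m) (hgz : T g = z • g) :
    ∃ c : ℂ, g = c • f := by
  induction m with
  | zero => exact absurd (by simpa [initialSpan_zero] using hf) hf0
  | succ m ih =>
    by_cases hz : l m = z
    · have key : ∀ x ∈ initialSpan u m, T x = z • x → x = 0 := by
        intro x hx hxz
        by_contra hx0
        obtain ⟨i, hi, h⟩ := exists_diag_eq_of_map_eq_smul hT m hx hx0 hxz
        exact hi.ne (hl (h.symm.trans hz.symm))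
      obtain ⟨a, y, hy, rfl⟩ := exists_of_mem_initialSpan_succ hf
      obtain ⟨b, y', hy', rfl⟩ := exists_of_mem_initialSpan_succ hg
      have ha : a ≠ 0 := by
        rintro rfl
        exact hf0 (key _ (by simpa using hy) hfz)
      have h := key (a • (b • u m + y') - b • (a • u m + y)) (by
        have : a • (b • u m + y') - b • (a • u m + y) = a • y' - b • y := by module
        rw [this]
        exact Submodule.sub_mem _ (Submodule.smul_mem _ _ hy') (Submodule.smul_mem _ _ hy)) (by
        rw [map_sub, map_smul, map_smul, hfz, hgz]
        module)
      refine ⟨a⁻¹ * b, ?_⟩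
      rw [mul_smul, ← sub_eq_zero.1 h, inv_smul_smul₀ ha]
    · exact ih (mem_initialSpan_of_map_eq_smul hT hz hf hfz)
        (mem_initialSpan_of_map_eq_smul hT hz hg hgz)

end Triangular

lemma goldphi_pos : 0 < goldphi := Real.goldenRatio_pos

lemma one_lt_goldphi : 1 < goldphi := Real.one_lt_goldenRatio

lemma goldphi_sq : goldphi ^ 2 = goldphi + 1 := Real.goldenRatio_sq

lemma goldphi_inv_lt_one : goldphi⁻¹ < 1 := inv_lt_one_of_one_lt₀ one_lt_goldphi

lemma goldphi_inv_pos : 0 < goldphi⁻¹ := inv_pos.2 goldphi_pos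

lemma goldphi_inv_add_sq : goldphi⁻¹ + goldphi⁻¹ ^ 2 = 1 := by
  have := goldphi_pos.ne'
  field_simp
  linarith [goldphi_sq]

lemma goldphi_inv_mul_gpi_add : goldphi⁻¹ * gpi 0 + gpi 1 = gpi 0 := by
  have := goldphi_pos.ne'
  have h : goldphi ^ 2 + 1 ≠ 0 := by positivity
  simp only [gpi, if_true, one_ne_zero, if_false]
  field_simp
  linarith [goldphi_sq]

lemma goldphi_inv_sq_mul_gpi : goldphi⁻¹ ^ 2 * gpi 0 = gpi 1 := by
  have := goldphi_pos.ne'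
  have h : goldphi ^ 2 + 1 ≠ 0 := by positivity
  simp only [gpi, if_true, one_ne_zero, if_false]
  field_simp

lemma gpi_pos (i : Fin 2) : 0 < gpi i := by
  have := goldphi_pos
  unfold gpi
  split_ifs <;> positivity

lemma gP_nonneg (i j : Fin 2) : 0 ≤ gP i j := by
  have := goldphi_inv_pos
  unfold gP
  split_ifs <;> positivity

/-- The sequence `ω` with the letter `j` put in front. -/
def consSeq (j : Fin 2) (ω : ℕ → Fin 2) : ℕ → Fin 2
  | 0 => j
  | n + 1 => ω n

lemma shift_consSeq (j : Fin 2) (ω : ℕ → Fin 2) : shift (consSeq j ω) = ω := rfl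

lemma measurable_consSeq (j : Fin 2) : Measurable (consSeq j) := by
  refine measurable_pi_iff.2 fun n => ?_
  cases n with
  | zero => exact measurable_const
  | succ n => exact measurable_pi_apply n

lemma measurable_shift : Measurable shift :=
  measurable_pi_iff.2 fun n => measurable_pi_apply (n + 1)

lemma measurableSet_first (i : Fin 2) : MeasurableSet {ω : ℕ → Fin 2 | ω 0 = i} :=
  measurableSet_eq_fun (measurable_pi_apply 0) measurable_const

lemma measurableSet_piNat_cylinder (x : ℕ → Fin 2) (n : ℕ) :
    MeasurableSet (PiNat.cylinder x n) :=
  (PiNat.isOpen_cylinder (fun _ => Fin 2) x n).measurableSet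

lemma isPiSystem_piNat_cylinder :
    IsPiSystem {s : Set (ℕ → Fin 2) | ∃ (x : ℕ → Fin 2) (n : ℕ), s = PiNat.cylinder x n} := by
  rintro _ ⟨x, n, rfl⟩ _ ⟨y, m, rfl⟩ ⟨z, hz, hz'⟩
  rw [← PiNat.mem_cylinder_iff_eq.1 hz, ← PiNat.mem_cylinder_iff_eq.1 hz']
  rcases le_total n m with h | h
  · exact ⟨z, m, Set.inter_eq_self_of_subset_right (PiNat.cylinder_anti z h)⟩
  · exact ⟨z, n, Set.inter_eq_self_of_subset_left (PiNat.cylinder_anti z h)⟩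

lemma generateFrom_piNat_cylinder :
    (inferInstance : MeasurableSpace (ℕ → Fin 2)) = MeasurableSpace.generateFrom
      {s : Set (ℕ → Fin 2) | ∃ (x : ℕ → Fin 2) (n : ℕ), s = PiNat.cylinder x n} := by
  rw [← (PiNat.isTopologicalBasis_cylinders (fun _ => Fin 2)).borel_eq_generateFrom]
  exact BorelSpace.measurable_eq

section Markov

variable {μ : Measure (ℕ → Fin 2)}

lemma IsGoldenMarkov.measure_cylinder_succ (hμ : IsGoldenMarkov μ) (x : ℕ → Fin 2) (r : ℕ) :
    μ (PiNat.cylinder x (r + 1)) =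
      ENNReal.ofReal (gpi (x 0) * ∏ k ∈ Finset.range r, gP (x k) (x (k + 1))) := by
  rw [← hμ r x]
  congr 1
  ext ω
  simp [PiNat.mem_cylinder_iff]

lemma IsGoldenMarkov.measure_first (hμ : IsGoldenMarkov μ) (i : Fin 2) :
    μ {ω | ω 0 = i} = ENNReal.ofReal (gpi i) := by
  have h := hμ 0 fun _ => i
  simpa using h

lemma map_consSeq_cylinder (i j : Fin 2) (x : ℕ → Fin 2) (r : ℕ) :
    (μ.restrict {ω | ω 0 = i}).map (consSeq j) (PiNat.cylinder x (r + 2)) =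
      if x 0 = j ∧ x 1 = i then μ (PiNat.cylinder (shift x) (r + 1)) else 0 := by
  rw [Measure.map_apply (measurable_consSeq j) (measurableSet_piNat_cylinder _ _),
    Measure.restrict_apply (measurable_consSeq j (measurableSet_piNat_cylinder _ _))]
  have h : ∀ ω, ω ∈ consSeq j ⁻¹' PiNat.cylinder x (r + 2) ↔
      j = x 0 ∧ ω ∈ PiNat.cylinder (shift x) (r + 1) := by
    intro ω
    rw [Set.mem_preimage, PiNat.mem_cylinder_iff, PiNat.mem_cylinder_iff]
    constructor
    · exact fun h => ⟨h 0 (by omega), fun k hk => h (k + 1) (by omega)⟩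
    · rintro ⟨h0, h⟩ (_ | k) hk
      · exact h0
      · exact h k (by omega)
  split_ifs with hx
  · congr 1
    ext ω
    rw [Set.mem_inter_iff, h]
    refine ⟨fun hω => hω.1.2, fun hω => ⟨⟨hx.1.symm, hω⟩, ?_⟩⟩
    exact (PiNat.mem_cylinder_iff.1 hω 0 (by omega)).trans hx.2
  · convert measure_empty (μ := μ)
    ext ω
    rw [Set.mem_inter_iff, h]
    simp only [Set.mem_ofPred_eq, Set.mem_empty_iff_false, iff_false]
    rintro ⟨⟨h0, hω⟩, hi⟩
    exact hx ⟨h0.symm, (PiNat.mem_cylinder_iff.1 hω 0 (by omega)).symm.trans hi⟩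

lemma map_consSeq_cylinder_one (i j : Fin 2) (x : ℕ → Fin 2) :
    (μ.restrict {ω | ω 0 = i}).map (consSeq j) (PiNat.cylinder x 1) =
      if x 0 = j then μ {ω | ω 0 = i} else 0 := by
  rw [Measure.map_apply (measurable_consSeq j) (measurableSet_piNat_cylinder _ _),
    Measure.restrict_apply (measurable_consSeq j (measurableSet_piNat_cylinder _ _))]
  have h : ∀ ω, ω ∈ consSeq j ⁻¹' PiNat.cylinder x 1 ↔ x 0 = j := by
    intro ω
    simp [PiNat.mem_cylinder_iff, consSeq, eq_comm]
  split_ifs with hx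
  · congr 1
    ext ω
    simp [h, hx]
  · convert measure_empty (μ := μ)
    ext ω
    simp [h, hx]

/-- The Markov measure decomposed according to the first letter. -/
lemma IsGoldenMarkov.eq_sum_map [IsProbabilityMeasure μ] (hμ : IsGoldenMarkov μ) :
    μ = ENNReal.ofReal goldphi⁻¹ • (μ.restrict {ω | ω 0 = 0}).map (consSeq 0)
      + ENNReal.ofReal (goldphi⁻¹ ^ 2) • (μ.restrict {ω | ω 0 = 0}).map (consSeq 1)
      + (μ.restrict {ω | ω 0 = 1}).map (consSeq 0) := by
  have hp := goldphi_inv_pos.le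
  have h0 := (gpi_pos 0).le
  have h1 := (gpi_pos 1).le
  have huniv : ∀ i j, (μ.restrict {ω | ω 0 = i}).map (consSeq j) Set.univ
      = ENNReal.ofReal (gpi i) := by
    intro i j
    rw [Measure.map_apply (measurable_consSeq j) MeasurableSet.univ, Set.preimage_univ,
      Measure.restrict_apply_univ, hμ.measure_first]
  have htot : μ Set.univ = (ENNReal.ofReal goldphi⁻¹ • (μ.restrict {ω | ω 0 = 0}).map (consSeq 0)
      + ENNReal.ofReal (goldphi⁻¹ ^ 2) • (μ.restrict {ω | ω 0 = 0}).map (consSeq 1)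
      + (μ.restrict {ω | ω 0 = 1}).map (consSeq 0)) Set.univ := by
    simp only [Measure.add_apply, Measure.smul_apply, huniv, smul_eq_mul, measure_univ]
    rw [← ENNReal.ofReal_mul hp, ← ENNReal.ofReal_mul (by positivity),
      ← ENNReal.ofReal_add (by positivity) (by positivity),
      ← ENNReal.ofReal_add (by positivity) h1]
    have : goldphi⁻¹ * gpi 0 + goldphi⁻¹ ^ 2 * gpi 0 + gpi 1 = 1 := by
      rw [← add_mul, goldphi_inv_add_sq]
      have h : goldphi ^ 2 + 1 ≠ 0 := by positivity
      simp only [gpi, if_true, one_ne_zero, if_false]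
      field_simp
    rw [this, ENNReal.ofReal_one]
  refine ext_of_generate_finite _ generateFrom_piNat_cylinder isPiSystem_piNat_cylinder ?_ htot
  rintro _ ⟨x, n, rfl⟩
  rcases n with _ | _ | r
  · rw [PiNat.cylinder_zero]
    exact htot
  · simp only [Measure.add_apply, Measure.smul_apply, smul_eq_mul, zero_add,
      map_consSeq_cylinder_one, hμ.measure_first]
    rw [hμ.measure_cylinder_succ x 0]
    obtain h | h : x 0 = 0 ∨ x 0 = 1 := by omega
    · simp only [h, Finset.range_zero, Finset.prod_empty, mul_one, if_true, zero_ne_one, if_false,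
        mul_zero, add_zero]
      rw [← ENNReal.ofReal_mul hp, ← ENNReal.ofReal_add (by positivity) h1,
        goldphi_inv_mul_gpi_add]
    · simp only [h, Finset.range_zero, Finset.prod_empty, mul_one, if_true, one_ne_zero, if_false,
        mul_zero, add_zero, zero_add]
      rw [← ENNReal.ofReal_mul (by positivity), goldphi_inv_sq_mul_gpi]
  · simp only [Measure.add_apply, Measure.smul_apply, smul_eq_mul, map_consSeq_cylinder]
    rw [hμ.measure_cylinder_succ, hμ.measure_cylinder_succ, Finset.prod_range_succ']
    have hprod : 0 ≤ ∏ k ∈ Finset.range r, gP (x (k + 1)) (x (k + 1 + 1)) :=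
      Finset.prod_nonneg fun k _ => gP_nonneg _ _
    simp only [shift]
    generalize (∏ k ∈ Finset.range r, gP (x (k + 1)) (x (k + 1 + 1))) = Q at hprod ⊢
    obtain h | h : x 0 = 0 ∨ x 0 = 1 := by omega
    all_goals obtain h' | h' : x 1 = 0 ∨ x 1 = 1 := by omega
    all_goals simp only [h, h', gP, zero_add, and_self, and_true, if_true, if_false,
      one_ne_zero, zero_ne_one, and_false, mul_zero, add_zero, ENNReal.ofReal_zero,
      mul_one]
    · rw [← ENNReal.ofReal_mul hp]
      congr 1
      ring
    · rw [← goldphi_inv_sq_mul_gpi]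
      congr 1
      ring
    · rw [← ENNReal.ofReal_mul (by positivity), ← goldphi_inv_sq_mul_gpi]
      congr 1
      ring

/-- The transfer operator of the golden-ratio subshift, on functions. -/
def transfer (F : (ℕ → Fin 2) → ℂ) (ω : ℕ → Fin 2) : ℂ :=
  if ω 0 = 0 then (goldphi⁻¹ : ℝ) * F (consSeq 0 ω) + ((goldphi⁻¹ ^ 2 : ℝ) : ℂ) * F (consSeq 1 ω)
  else F (consSeq 0 ω)

lemma IsGoldenMarkov.integral_eq_transfer [IsProbabilityMeasure μ] (hμ : IsGoldenMarkov μ)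
    {G : (ℕ → Fin 2) → ℂ} (hG : Measurable G) (hGi : Integrable G μ) :
    ∫ ω, G ω ∂μ = ∫ ω, transfer G ω ∂μ := by
  have hp := goldphi_inv_pos
  have hGi' := hGi
  rw [hμ.eq_sum_map, integrable_add_measure, integrable_add_measure,
    integrable_smul_measure (ENNReal.ofReal_pos.2 hp).ne' (by simp),
    integrable_smul_measure (ENNReal.ofReal_pos.2 (by positivity)).ne' (by simp)] at hGi'
  obtain ⟨⟨ha, hb⟩, hc⟩ := hGi'
  have ha' : Integrable (fun ω => G (consSeq 0 ω)) (μ.restrict {ω | ω 0 = 0}) :=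
    (integrable_map_measure hG.aestronglyMeasurable
      (measurable_consSeq 0).aemeasurable).1 ha
  have hb' : Integrable (fun ω => G (consSeq 1 ω)) (μ.restrict {ω | ω 0 = 0}) :=
    (integrable_map_measure hG.aestronglyMeasurable
      (measurable_consSeq 1).aemeasurable).1 hb
  have hc' : Integrable (fun ω => G (consSeq 0 ω)) (μ.restrict {ω | ω 0 = 1}) :=
    (integrable_map_measure hG.aestronglyMeasurable
      (measurable_consSeq 0).aemeasurable).1 hc
  have hcompl : {ω : ℕ → Fin 2 | ω 0 = 0}ᶜ = {ω | ω 0 = 1} := by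
    ext ω
    simp only [Set.mem_compl_iff, Set.mem_ofPred_eq]
    omega
  have h0 : ∀ ω ∈ {ω : ℕ → Fin 2 | ω 0 = 0}, transfer G ω
      = (goldphi⁻¹ : ℝ) * G (consSeq 0 ω) + ((goldphi⁻¹ ^ 2 : ℝ) : ℂ) * G (consSeq 1 ω) :=
    fun ω hω => if_pos hω
  have h1 : ∀ ω ∈ {ω : ℕ → Fin 2 | ω 0 = 1}, transfer G ω = G (consSeq 0 ω) := by
    intro ω hω
    rw [← hcompl] at hω
    exact if_neg hω
  have hi0 : IntegrableOn (transfer G) {ω | ω 0 = 0} μ :=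
    ((ha'.const_mul _).add (hb'.const_mul _)).congr
      (ae_restrict_of_forall_mem (measurableSet_first 0) fun ω hω => (h0 ω hω).symm)
  have hi1 : IntegrableOn (transfer G) {ω | ω 0 = 1} μ :=
    hc'.congr (ae_restrict_of_forall_mem (measurableSet_first 1) fun ω hω => (h1 ω hω).symm)
  have hi : Integrable (transfer G) μ := by
    rw [← integrableOn_univ, ← Set.union_compl_self {ω : ℕ → Fin 2 | ω 0 = 0}, hcompl]
    exact hi0.union hi1
  rw [← integral_add_compl (measurableSet_first 0) hi, hcompl,
    setIntegral_congr_fun (measurableSet_first 0) h0,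
    setIntegral_congr_fun (measurableSet_first 1) h1,
    integral_add (ha'.const_mul _) (hb'.const_mul _), integral_const_mul, integral_const_mul]
  conv_lhs => rw [hμ.eq_sum_map]
  rw [integral_add_measure ((ha.smul_measure (by simp)).add_measure (hb.smul_measure (by simp))) hc,
    integral_add_measure (ha.smul_measure (by simp)) (hb.smul_measure (by simp)),
    integral_smul_measure, integral_smul_measure,
    integral_map (measurable_consSeq 0).aemeasurable hG.aestronglyMeasurable,
    integral_map (measurable_consSeq 1).aemeasurable hG.aestronglyMeasurable,
    integral_map (measurable_consSeq 0).aemeasurable hG.aestronglyMeasurable,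
    ENNReal.toReal_ofReal hp.le, ENNReal.toReal_ofReal (by positivity),
    Complex.real_smul, Complex.real_smul]

lemma IsGoldenMarkov.adjoint_eq [IsProbabilityMeasure μ] (hμ : IsGoldenMarkov μ)
    {U : Lp ℂ 2 μ →L[ℂ] Lp ℂ 2 μ}
    (hU : ∀ f : Lp ℂ 2 μ, ⇑(U f) =ᵐ[μ] fun ω => f (shift ω))
    {F : (ℕ → Fin 2) → ℂ} (hF : Measurable F) {f k : Lp ℂ 2 μ}
    (hf : ⇑f =ᵐ[μ] F) (hk : ⇑k =ᵐ[μ] transfer F) :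
    ContinuousLinearMap.adjoint U f = k := by
  refine ext_inner_right ℂ fun g => ?_
  rw [ContinuousLinearMap.adjoint_inner_left, L2.inner_def, L2.inner_def]
  have hgm : Measurable g := (Lp.stronglyMeasurable g).measurable
  set G : (ℕ → Fin 2) → ℂ := fun ω => inner ℂ (F ω) (g (shift ω)) with hG
  have hGm : Measurable G := hF.inner (hgm.comp measurable_shift)
  have hae : (fun ω => inner ℂ (f ω) ((U g) ω)) =ᵐ[μ] G := by
    filter_upwards [hf, hU g] with ω h1 h2
    rw [hG, h1, h2]
  have hGi : Integrable G μ := (L2.integrable_inner f (U g)).congr hae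
  rw [integral_congr_ae hae, hμ.integral_eq_transfer hGm hGi]
  refine integral_congr_ae ?_
  filter_upwards [hk] with ω h
  rw [h]
  simp only [transfer, hG, shift_consSeq, RCLike.inner_apply]
  split_ifs
  · simp only [map_add, map_mul, Complex.conj_ofReal]
    ring
  · rfl

end Markov

lemma hGold_term_nonneg (ω : ℕ → Fin 2) (k : ℕ) : 0 ≤ (ω k : ℝ) * goldphi⁻¹ ^ (k + 1) := by
  have := goldphi_inv_pos
  positivity

lemma hGold_term_le (ω : ℕ → Fin 2) (k : ℕ) :
    (ω k : ℝ) * goldphi⁻¹ ^ (k + 1) ≤ goldphi⁻¹ * goldphi⁻¹ ^ k := by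
  have := goldphi_inv_pos
  have h : (ω k : ℝ) ≤ 1 := by
    have : (ω k : ℕ) ≤ 1 := by omega
    exact_mod_cast this
  rw [pow_succ']
  exact mul_le_of_le_one_left (by positivity) h

lemma summable_goldphi : Summable fun k : ℕ => goldphi⁻¹ * goldphi⁻¹ ^ k :=
  (summable_geometric_of_lt_one goldphi_inv_pos.le goldphi_inv_lt_one).mul_left _

lemma summable_hGold (ω : ℕ → Fin 2) :
    Summable fun k : ℕ => (ω k : ℝ) * goldphi⁻¹ ^ (k + 1) :=
  summable_goldphi.of_nonneg_of_le (hGold_term_nonneg ω) (hGold_term_le ω)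

lemma hGold_nonneg (ω : ℕ → Fin 2) : 0 ≤ hGold ω := tsum_nonneg (hGold_term_nonneg ω)

lemma hGold_le (ω : ℕ → Fin 2) : hGold ω ≤ goldphi := by
  have h : ∑' k : ℕ, goldphi⁻¹ * goldphi⁻¹ ^ k = goldphi := by
    rw [tsum_mul_left, tsum_geometric_of_lt_one goldphi_inv_pos.le goldphi_inv_lt_one]
    have h2 : 1 - goldphi⁻¹ = goldphi⁻¹ ^ 2 := by linarith [goldphi_inv_add_sq]
    have := goldphi_pos.ne'
    rw [h2]
    field_simp
  exact ((summable_hGold ω).tsum_le_tsum (hGold_term_le ω) summable_goldphi).trans_eq h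

lemma measurable_hGold : Measurable hGold := by
  refine Continuous.measurable (continuous_tsum (fun k => ?_) summable_goldphi fun k ω => ?_)
  · exact ((continuous_of_discreteTopology (f := fun i : Fin 2 => (i : ℝ))).comp
      (continuous_apply k)).mul continuous_const
  · rw [Real.norm_of_nonneg (hGold_term_nonneg ω k)]
    exact hGold_term_le ω k

lemma hGold_consSeq (j : Fin 2) (ω : ℕ → Fin 2) :
    hGold (consSeq j ω) = goldphi⁻¹ * ((j : ℝ) + hGold ω) := by
  rw [hGold, (summable_hGold (consSeq j ω)).tsum_eq_zero_add, hGold, mul_add, ← tsum_mul_left]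
  congr 1
  · simp [consSeq, mul_comm]
  · refine tsum_congr fun k => ?_
    simp only [consSeq]
    ring

lemma hGold_le_of_forall_eq_zero {m : ℕ} {ω : ℕ → Fin 2} (h : ∀ k < m, ω k = 0) :
    hGold ω ≤ goldphi⁻¹ ^ m * goldphi := by
  induction m generalizing ω with
  | zero => simpa using hGold_le ω
  | succ m ih =>
    have hω : consSeq 0 (shift ω) = ω := by
      funext n
      cases n with
      | zero => exact (h 0 (by omega)).symm
      | succ n => rfl
    have hs := ih (ω := shift ω) fun k hk => h (k + 1) (by omega)
    rw [← hω, hGold_consSeq, pow_succ', mul_assoc]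
    simpa using mul_le_mul_of_nonneg_left hs goldphi_inv_pos.le

lemma hGold_pos_of_eq_one {m : ℕ} {ω : ℕ → Fin 2} (h : ω m = 1) : 0 < hGold ω := by
  have hp := goldphi_inv_pos
  refine lt_of_lt_of_le ?_ ((summable_hGold ω).le_tsum m fun k _ => hGold_term_nonneg ω k)
  rw [h]
  simp only [Fin.val_one, Nat.cast_one, one_mul]
  positivity

lemma IsGoldenMarkov.exists_cylinder_hGold_lt
    {μ : Measure (ℕ → Fin 2)} (hμ : IsGoldenMarkov μ)
    {ε : ℝ} (hε : 0 < ε) :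
    ∃ s : Set (ℕ → Fin 2), μ s ≠ 0 ∧ ∀ ω ∈ s, ω 0 = 0 ∧ 0 < hGold ω ∧ hGold ω < ε := by
  obtain ⟨m, hm⟩ := exists_pow_lt_of_lt_one (div_pos hε goldphi_pos) goldphi_inv_lt_one
  have hm' : goldphi⁻¹ ^ (m + 1) * goldphi < ε := by
    rw [← lt_div_iff₀ goldphi_pos]
    exact (pow_le_pow_of_le_one goldphi_inv_pos.le goldphi_inv_lt_one.le m.le_succ).trans_lt hm
  set x : ℕ → Fin 2 := fun k => if k = m + 1 then 1 else 0 with hx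
  refine ⟨PiNat.cylinder x (m + 2), ?_, fun ω hω => ?_⟩
  · rw [hμ.measure_cylinder_succ]
    refine (ENNReal.ofReal_pos.2 (mul_pos (gpi_pos _) (Finset.prod_pos fun k hk => ?_))).ne'
    have hk' : k ≠ m + 1 := by
      have := Finset.mem_range.1 hk
      omega
    have hp := goldphi_inv_pos
    simp only [hx, gP, if_neg hk', if_true]
    split_ifs <;> positivity
  · rw [PiNat.mem_cylinder_iff] at hω
    have h0 : ∀ k < m + 1, ω k = 0 := fun k hk => by
      rw [hω k (by omega), hx]
      exact if_neg hk.ne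
    have h1 : ω (m + 1) = 1 := by
      rw [hω _ (by omega), hx]
      exact if_pos rfl
    exact ⟨h0 0 (by omega), hGold_pos_of_eq_one h1, (hGold_le_of_forall_eq_zero h0).trans_lt hm'⟩

/-- The function `𝟙_{C[j]} hᵏ`. -/
def blockFun (j : Fin 2) (k : ℕ) (ω : ℕ → Fin 2) : ℂ := indC j ω * (hGold ω : ℂ) ^ k

lemma measurable_blockFun (j : Fin 2) (k : ℕ) : Measurable (blockFun j k) :=
  (Measurable.ite (measurableSet_first j) measurable_const measurable_const).mul
    ((Complex.measurable_ofReal.comp measurable_hGold).pow_const k)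

lemma norm_blockFun_le (j : Fin 2) (k : ℕ) (ω : ℕ → Fin 2) : ‖blockFun j k ω‖ ≤ goldphi ^ k := by
  rw [blockFun, norm_mul, norm_pow, Complex.norm_real, Real.norm_of_nonneg (hGold_nonneg ω)]
  have h1 : ‖indC j ω‖ ≤ 1 := by
    unfold indC
    split_ifs <;> simp
  have h2 := pow_le_pow_left₀ (hGold_nonneg ω) (hGold_le ω) k
  exact (mul_le_of_le_one_left (pow_nonneg (hGold_nonneg ω) k) h1).trans h2

lemma transfer_blockFun_zero (k : ℕ) (ω : ℕ → Fin 2) :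
    transfer (blockFun 0 k) ω = ((goldphi : ℂ) ^ (k + 1))⁻¹ * blockFun 0 k ω
      + ((goldphi : ℂ) ^ k)⁻¹ * blockFun 1 k ω := by
  obtain h | h : ω 0 = 0 ∨ ω 0 = 1 := by omega
  all_goals
    simp only [transfer, blockFun, indC, hGold_consSeq, consSeq, h]
    simp [mul_pow, pow_succ']
    try ring

lemma transfer_blockFun_one (k : ℕ) (ω : ℕ → Fin 2) :
    transfer (blockFun 1 k) ω = ∑ i ∈ Finset.range (k + 1),
      (((goldphi : ℂ) ^ (k + 2))⁻¹ * (k.choose i : ℂ)) * blockFun 0 i ω := by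
  obtain h | h : ω 0 = 0 ∨ ω 0 = 1 := by omega
  · simp only [transfer, blockFun, indC, hGold_consSeq, consSeq, h]
    simp only [if_true, zero_ne_one, if_false, zero_mul, mul_zero, zero_add, one_mul, mul_assoc]
    rw [← Finset.mul_sum]
    push_cast
    rw [mul_pow, add_comm _ (hGold ω : ℂ), add_pow, ← mul_assoc]
    congr 1
    · rw [← pow_add, inv_pow, add_comm]
    · refine Finset.sum_congr rfl fun i _ => ?_
      simp [mul_comm]
  · simp [transfer, blockFun, indC, hGold_consSeq, consSeq, h]

section BlockBasis

variable (μ : Measure (ℕ → Fin 2)) [IsProbabilityMeasure μ]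

lemma memLp_blockFun (j : Fin 2) (k : ℕ) : MemLp (blockFun j k) 2 μ :=
  MemLp.of_bound (measurable_blockFun j k).aestronglyMeasurable (goldphi ^ k)
    (ae_of_all _ (norm_blockFun_le j k))

/-- The element `𝟙_{C[j]} hᵏ` of `L²`. -/
def blockVec (j : Fin 2) (k : ℕ) : Lp ℂ 2 μ := (memLp_blockFun μ j k).toLp _

lemma coeFn_blockVec (j : Fin 2) (k : ℕ) : ⇑(blockVec μ j k) =ᵐ[μ] blockFun j k :=
  MemLp.coeFn_toLp _

lemma coeFn_sum_smul_blockVec {ι : Type*} (s : Finset ι) (c : ι → ℂ) (j : ι → Fin 2)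
    (k : ι → ℕ) : ⇑(∑ i ∈ s, c i • blockVec μ (j i) (k i)) =ᵐ[μ]
      fun ω => ∑ i ∈ s, c i * blockFun (j i) (k i) ω := by
  classical
  induction s using Finset.induction_on with
  | empty =>
    simp only [Finset.sum_empty]
    exact Lp.coeFn_zero ℂ 2 μ
  | insert a s ha ih =>
    rw [Finset.sum_insert ha]
    filter_upwards [ih, Lp.coeFn_add (c a • blockVec μ (j a) (k a))
      (∑ i ∈ s, c i • blockVec μ (j i) (k i)), Lp.coeFn_smul (c a) (blockVec μ (j a) (k a)),
      coeFn_blockVec μ (j a) (k a)] with ω h1 h2 h3 h4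
    rw [h2, Pi.add_apply, h1, h3, Pi.smul_apply, h4, smul_eq_mul, Finset.sum_insert ha]

/-- The subspace `W ⊗ span{1, …, h^{n-1}}` of `L²`. -/
def blockSpan (n : ℕ) : Submodule ℂ (Lp ℂ 2 μ) :=
  Submodule.span ℂ ((fun p : ℕ × Fin 2 => blockVec μ p.2 p.1) ''
    ↑(Finset.range n ×ˢ (Finset.univ : Finset (Fin 2))))

variable {μ}

lemma blockVec_mem_blockSpan (j : Fin 2) {k n : ℕ} (h : k < n) :
    blockVec μ j k ∈ blockSpan μ n :=
  Submodule.subset_span ⟨(k, j), by simpa using h, rfl⟩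

lemma inXlt_iff (n : ℕ) (f : Lp ℂ 2 μ) : InXlt μ n f ↔ f ∈ blockSpan μ n := by
  have key : ∀ c : ℕ × Fin 2 → ℂ,
      (∑ p ∈ Finset.range n ×ˢ (Finset.univ : Finset (Fin 2)), c p • blockVec μ p.2 p.1 = f) ↔
      ⇑f =ᵐ[μ] fun ω => ∑ k ∈ Finset.range n, ∑ j : Fin 2,
        c (k, j) * indC j ω * (hGold ω : ℂ) ^ k := by
    intro c
    have h := coeFn_sum_smul_blockVec μ (Finset.range n ×ˢ (Finset.univ : Finset (Fin 2))) c
      Prod.snd Prod.fst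
    have hsum : ∀ ω, ∑ p ∈ Finset.range n ×ˢ (Finset.univ : Finset (Fin 2)),
        c p * blockFun p.2 p.1 ω = ∑ k ∈ Finset.range n, ∑ j : Fin 2,
          c (k, j) * indC j ω * (hGold ω : ℂ) ^ k := fun ω => by
      rw [Finset.sum_product]
      simp only [blockFun, mul_assoc]
    simp only [hsum] at h
    constructor
    · rintro rfl
      exact h
    · exact fun hf => Lp.ext (h.trans hf.symm)
  rw [blockSpan, Submodule.mem_span_image_finset_iff_exists_fun']
  simp only [key, InXlt]
  constructor
  · rintro ⟨c, hc⟩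
    exact ⟨fun p => c p.2 p.1, hc⟩
  · rintro ⟨c, hc⟩
    exact ⟨fun j k => c (k, j), hc⟩

end BlockBasis

lemma goldphi_complex_ne_zero : (goldphi : ℂ) ≠ 0 := by
  exact_mod_cast goldphi_pos.ne'

lemma goldphi_complex_sq : (goldphi : ℂ) ^ 2 = goldphi + 1 := by
  exact_mod_cast goldphi_sq

/-- The ratio of the coordinates of the eigenvectors of the diagonal blocks `Q_{m/2}`. -/
def blockSlope (m : ℕ) : ℂ := if m % 2 = 0 then 1 else -(goldphi : ℂ) ^ 2

/-- The eigenvalues of the diagonal blocks `Q_{m/2}`. -/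
def blockEigenvalue (m : ℕ) : ℂ :=
  if m % 2 = 0 then ((goldphi : ℂ) ^ (m / 2))⁻¹ else -((goldphi : ℂ) ^ (m / 2 + 2))⁻¹

lemma blockEigenvalue_even (n : ℕ) : blockEigenvalue (2 * n) = ((goldphi : ℂ) ^ n)⁻¹ := by
  rw [blockEigenvalue, if_pos (by omega), show 2 * n / 2 = n by omega]

lemma blockEigenvalue_odd (n : ℕ) :
    blockEigenvalue (2 * n + 1) = -((goldphi : ℂ) ^ (n + 2))⁻¹ := by
  rw [blockEigenvalue, if_neg (by omega), show (2 * n + 1) / 2 = n by omega]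

lemma blockEigenvalue_injective : Function.Injective blockEigenvalue := by
  have hinj : ∀ a b : ℕ, ((goldphi : ℂ) ^ a)⁻¹ = ((goldphi : ℂ) ^ b)⁻¹ → a = b := by
    intro a b h
    have h' : goldphi ^ a = goldphi ^ b := by exact_mod_cast inv_injective h
    exact pow_right_injective₀ goldphi_pos one_lt_goldphi.ne' h'
  have hne : ∀ a b : ℕ, ((goldphi : ℂ) ^ a)⁻¹ ≠ -((goldphi : ℂ) ^ b)⁻¹ := by
    intro a b h
    have h' : (goldphi ^ a)⁻¹ = -(goldphi ^ b)⁻¹ := by exact_mod_cast h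
    have ha := inv_pos.2 (pow_pos goldphi_pos a)
    have hb := inv_pos.2 (pow_pos goldphi_pos b)
    linarith
  intro m n h
  obtain ⟨a, rfl | rfl⟩ := m.even_or_odd'
  all_goals obtain ⟨b, rfl | rfl⟩ := n.even_or_odd'
  all_goals simp only [blockEigenvalue_even, blockEigenvalue_odd] at h
  · rw [hinj _ _ h]
  · exact absurd h (hne _ _)
  · exact absurd h.symm (hne _ _)
  · have := hinj _ _ (neg_injective h)
    omega

section BlockEigen

variable (μ : Measure (ℕ → Fin 2)) [IsProbabilityMeasure μ]

/-- Eigenvectors of the diagonal blocks `Q_{m/2}`, as elements of `L²`. -/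
def blockEigenvector (m : ℕ) : Lp ℂ 2 μ :=
  blockVec μ 0 (m / 2) + blockSlope m • blockVec μ 1 (m / 2)

lemma initialSpan_blockEigenvector (n : ℕ) :
    initialSpan (blockEigenvector μ) (2 * n) = blockSpan μ n := by
  refine le_antisymm (Submodule.span_le.2 ?_) (Submodule.span_le.2 ?_)
  · rintro _ ⟨m, hm, rfl⟩
    have : m / 2 < n := by
      have : m < 2 * n := hm
      omega
    exact Submodule.add_mem _ (blockVec_mem_blockSpan 0 this)
      (Submodule.smul_mem _ _ (blockVec_mem_blockSpan 1 this))
  · rintro _ ⟨⟨k, j⟩, hk, rfl⟩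
    have hk : k < n := by simpa using hk
    have he := mem_initialSpan_of_lt (blockEigenvector μ) (show 2 * k < 2 * n by omega)
    have ho := mem_initialSpan_of_lt (blockEigenvector μ) (show 2 * k + 1 < 2 * n by omega)
    rw [blockEigenvector, blockSlope, if_pos (by omega), show 2 * k / 2 = k by omega,
      one_smul] at he
    rw [blockEigenvector, blockSlope, if_neg (by omega), show (2 * k + 1) / 2 = k by omega] at ho
    have hne : 1 + (goldphi : ℂ) ^ 2 ≠ 0 := by
      have : 1 + goldphi ^ 2 ≠ 0 := by positivity
      exact_mod_cast this
    have h1 : blockVec μ 1 k ∈ initialSpan (blockEigenvector μ) (2 * n) := by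
      have h := Submodule.smul_mem _ (1 + (goldphi : ℂ) ^ 2)⁻¹ (Submodule.sub_mem _ he ho)
      have heq : blockVec μ 0 k + blockVec μ 1 k
          - (blockVec μ 0 k + -(goldphi : ℂ) ^ 2 • blockVec μ 1 k)
          = (1 + (goldphi : ℂ) ^ 2) • blockVec μ 1 k := by module
      rwa [heq, inv_smul_smul₀ hne] at h
    obtain rfl | rfl : j = 0 ∨ j = 1 := by omega
    · simpa using Submodule.sub_mem _ he h1
    · exact h1

variable {μ}

lemma IsGoldenMarkov.add_smul_notMem_blockSpan (hμ : IsGoldenMarkov μ) (s : ℂ) (k : ℕ) :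
    blockVec μ 0 k + s • blockVec μ 1 k ∉ blockSpan μ k := by
  rw [← inXlt_iff]
  rintro ⟨c, hc⟩
  set p : Polynomial ℂ := Polynomial.X ^ k
    - ∑ i ∈ Finset.range k, Polynomial.C (c 0 i) * Polynomial.X ^ i with hp
  have hp0 : p ≠ 0 := by
    intro h
    have h1 : p.coeff k = 1 := by
      simp [hp, Polynomial.finsetSum_coeff, Polynomial.coeff_X_pow]
    simp [h] at h1
  have hfin : {t : ℝ | p.IsRoot (t : ℂ)}.Finite :=
    (Polynomial.finite_setOfPred_isRoot hp0).preimage Complex.ofReal_injective.injOn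
  have hnhds := (hfin.subset (Set.sdiff_subset (t := {(0 : ℝ)}))).isClosed.isOpen_compl.mem_nhds
    (show (0 : ℝ) ∈ ({t : ℝ | p.IsRoot (t : ℂ)} \ {0})ᶜ by simp)
  obtain ⟨ε, hε, hball⟩ := Metric.mem_nhds_iff.1 hnhds
  obtain ⟨A, hA, hAω⟩ := hμ.exists_cylinder_hGold_lt hε
  have hae : ∀ᵐ ω ∂μ, ω 0 = 0 → p.IsRoot (hGold ω : ℂ) := by
    filter_upwards [hc, Lp.coeFn_add (blockVec μ 0 k) (s • blockVec μ 1 k),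
      Lp.coeFn_smul s (blockVec μ 1 k), coeFn_blockVec μ 0 k, coeFn_blockVec μ 1 k]
      with ω h1 h2 h3 h4 h5 h0
    rw [h2, Pi.add_apply, h3, Pi.smul_apply, h4, h5] at h1
    simp only [blockFun, indC, h0, if_true, zero_ne_one, if_false, Fin.sum_univ_two] at h1
    simp only [hp, Polynomial.IsRoot.def, Polynomial.eval_sub, Polynomial.eval_finsetSum,
      Polynomial.eval_mul, Polynomial.eval_pow, Polynomial.eval_X, Polynomial.eval_C]
    rw [sub_eq_zero]
    simpa using h1
  obtain ⟨ω, hω, hroot⟩ := ((frequently_ae_mem_iff.2 hA).and_eventually hae).exists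
  obtain ⟨h0, hpos, hlt⟩ := hAω ω hω
  exact hball (show hGold ω ∈ Metric.ball 0 ε by simpa [abs_of_pos hpos] using hlt)
    ⟨hroot h0, hpos.ne'⟩

variable {U : Lp ℂ 2 μ →L[ℂ] Lp ℂ 2 μ}

lemma IsGoldenMarkov.adjoint_blockVec_zero (hμ : IsGoldenMarkov μ)
    (hU : ∀ f : Lp ℂ 2 μ, ⇑(U f) =ᵐ[μ] fun ω => f (shift ω)) (k : ℕ) :
    ContinuousLinearMap.adjoint U (blockVec μ 0 k)
      = ((goldphi : ℂ) ^ (k + 1))⁻¹ • blockVec μ 0 k + ((goldphi : ℂ) ^ k)⁻¹ • blockVec μ 1 k := by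
  refine hμ.adjoint_eq hU (measurable_blockFun 0 k) (coeFn_blockVec μ 0 k) ?_
  filter_upwards [Lp.coeFn_add (((goldphi : ℂ) ^ (k + 1))⁻¹ • blockVec μ 0 k)
    (((goldphi : ℂ) ^ k)⁻¹ • blockVec μ 1 k),
    Lp.coeFn_smul ((goldphi : ℂ) ^ (k + 1))⁻¹ (blockVec μ 0 k),
    Lp.coeFn_smul ((goldphi : ℂ) ^ k)⁻¹ (blockVec μ 1 k),
    coeFn_blockVec μ 0 k, coeFn_blockVec μ 1 k] with ω h1 h2 h3 h4 h5
  rw [h1, Pi.add_apply, h2, h3, Pi.smul_apply, Pi.smul_apply, h4, h5, transfer_blockFun_zero,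
    smul_eq_mul, smul_eq_mul]

lemma IsGoldenMarkov.adjoint_blockVec_one (hμ : IsGoldenMarkov μ)
    (hU : ∀ f : Lp ℂ 2 μ, ⇑(U f) =ᵐ[μ] fun ω => f (shift ω)) (k : ℕ) :
    ∃ r ∈ blockSpan μ k, ContinuousLinearMap.adjoint U (blockVec μ 1 k)
      = ((goldphi : ℂ) ^ (k + 2))⁻¹ • blockVec μ 0 k + r := by
  refine ⟨∑ i ∈ Finset.range k,
    (((goldphi : ℂ) ^ (k + 2))⁻¹ * (k.choose i : ℂ)) • blockVec μ 0 i,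
    Submodule.sum_mem _ fun i hi => Submodule.smul_mem _ _
      (blockVec_mem_blockSpan 0 (Finset.mem_range.1 hi)), ?_⟩
  rw [hμ.adjoint_eq hU (measurable_blockFun 1 k) (coeFn_blockVec μ 1 k)
    (k := ∑ i ∈ Finset.range (k + 1),
      (((goldphi : ℂ) ^ (k + 2))⁻¹ * (k.choose i : ℂ)) • blockVec μ 0 i)
    ((coeFn_sum_smul_blockVec μ _ _ (fun _ => 0) fun i => i).trans
      (ae_of_all _ fun ω => (transfer_blockFun_one k ω).symm)),
    Finset.sum_range_succ, add_comm]
  simp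

lemma IsGoldenMarkov.adjoint_blockEigenvector_sub_mem (hμ : IsGoldenMarkov μ)
    (hU : ∀ f : Lp ℂ 2 μ, ⇑(U f) =ᵐ[μ] fun ω => f (shift ω)) (m : ℕ) :
    ContinuousLinearMap.adjoint U (blockEigenvector μ m)
      - blockEigenvalue m • blockEigenvector μ m ∈ blockSpan μ (m / 2) := by
  obtain ⟨r, hr, h1⟩ := hμ.adjoint_blockVec_one hU (m / 2)
  have h0 := hμ.adjoint_blockVec_zero hU (m / 2)
  have hφ := goldphi_complex_ne_zero
  have hsq := goldphi_complex_sq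
  have ha : ((goldphi : ℂ) ^ (m / 2 + 1))⁻¹ + blockSlope m * ((goldphi : ℂ) ^ (m / 2 + 2))⁻¹
      - blockEigenvalue m = 0 := by
    unfold blockSlope blockEigenvalue
    split_ifs
    · field_simp
      linear_combination (-(goldphi : ℂ) * (goldphi : ℂ) ^ (m / 2 * 2)) * hsq
    · field_simp
      linear_combination (-(goldphi : ℂ) * (goldphi : ℂ) ^ (m / 2)) * hsq
  have hb : ((goldphi : ℂ) ^ (m / 2))⁻¹ - blockEigenvalue m * blockSlope m = 0 := by
    unfold blockSlope blockEigenvalue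
    split_ifs
    · simp
    · field_simp
      ring
  have : ContinuousLinearMap.adjoint U (blockEigenvector μ m)
      - blockEigenvalue m • blockEigenvector μ m = blockSlope m • r := by
    rw [blockEigenvector, map_add, map_smul, h0, h1]
    linear_combination (norm := module) ha • blockVec μ 0 (m / 2) + hb • blockVec μ 1 (m / 2)
  rw [this]
  exact Submodule.smul_mem _ _ hr

lemma IsGoldenMarkov.adjoint_sub_mem_initialSpan (hμ : IsGoldenMarkov μ)
    (hU : ∀ f : Lp ℂ 2 μ, ⇑(U f) =ᵐ[μ] fun ω => f (shift ω)) (m : ℕ) :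
    (ContinuousLinearMap.adjoint U : Lp ℂ 2 μ →ₗ[ℂ] Lp ℂ 2 μ) (blockEigenvector μ m)
      - blockEigenvalue m • blockEigenvector μ m ∈ initialSpan (blockEigenvector μ) m := by
  have h := hμ.adjoint_blockEigenvector_sub_mem hU m
  rw [← initialSpan_blockEigenvector] at h
  exact initialSpan_mono _ (by omega) h

lemma IsGoldenMarkov.exists_eigenvector (hμ : IsGoldenMarkov μ)
    (hU : ∀ f : Lp ℂ 2 μ, ⇑(U f) =ᵐ[μ] fun ω => f (shift ω)) (m : ℕ) :
    ∃ f ∈ blockSpan μ (m / 2 + 1), f ≠ 0 ∧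
      ContinuousLinearMap.adjoint U f = blockEigenvalue m • f := by
  have hy := hμ.adjoint_blockEigenvector_sub_mem hU m
  rw [← initialSpan_blockEigenvector] at hy
  obtain ⟨r, hr, hrz⟩ := exists_map_sub_smul_eq (hμ.adjoint_sub_mem_initialSpan hU)
    (z := blockEigenvalue m) (2 * (m / 2))
    (fun i hi h => by have := blockEigenvalue_injective h; omega) hy
  refine ⟨blockEigenvector μ m - r, ?_, ?_, ?_⟩
  · rw [← initialSpan_blockEigenvector]
    exact Submodule.sub_mem _ (mem_initialSpan_of_lt _ (by omega))
      (initialSpan_mono _ (by omega) hr)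
  · intro h
    rw [← sub_eq_zero.1 h, initialSpan_blockEigenvector] at hr
    exact hμ.add_smul_notMem_blockSpan _ _ hr
  · rw [map_sub, smul_sub]
    have hrz' : ContinuousLinearMap.adjoint U r - blockEigenvalue m • r
      = ContinuousLinearMap.adjoint U (blockEigenvector μ m)
        - blockEigenvalue m • blockEigenvector μ m := hrz
    rw [sub_eq_sub_iff_add_eq_add] at hrz' ⊢
    rw [← hrz', add_comm]

end BlockEigen

/-- `V_S` maps each `X_n = W ⊗ span{1,…,hⁿ}` into itself; in the basis
`𝟙_{C[0]}hᵏ, 𝟙_{C[1]}hᵏ` its matrix is block upper-triangular with diagonal blocks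
`Q_k = [[φ^{-k-1}, φ^{-k-2}], [φ^{-k}, 0]]` (i.e. modulo `X_{k−1}`,
`V(𝟙_{C[0]}hᵏ) = φ^{-k-1}𝟙_{C[0]}hᵏ + φ^{-k}𝟙_{C[1]}hᵏ` and
`V(𝟙_{C[1]}hᵏ) = φ^{-k-2}𝟙_{C[0]}hᵏ`); consequently the eigenvalues of `V_S` restricted to
`X = W ⊗ ℂ[h]` are exactly `{φ^{-n}} ∪ {−φ^{-n-2}}`, and each eigenspace of `V_S|_X` is
one-dimensional. -/
theorem stmt_18
    (μ : Measure (ℕ → Fin 2)) [IsProbabilityMeasure μ]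
    (hμ : IsGoldenMarkov μ)
    (hS : MeasurePreserving shift μ μ)
    (U V : Lp ℂ 2 μ →L[ℂ] Lp ℂ 2 μ)
    (hU : ∀ f : Lp ℂ 2 μ, ⇑(U f) =ᵐ[μ] fun ω => f (shift ω))
    (hV : V = ContinuousLinearMap.adjoint U) :
    (∀ (n : ℕ) (f : Lp ℂ 2 μ), InXlt μ (n + 1) f → InXlt μ (n + 1) (V f)) ∧
    (∀ (k : ℕ) (f0 f1 : Lp ℂ 2 μ),
      (⇑f0 =ᵐ[μ] fun ω => indC 0 ω * (hGold ω : ℂ) ^ k) →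
      (⇑f1 =ᵐ[μ] fun ω => indC 1 ω * (hGold ω : ℂ) ^ k) →
      (∃ r : Lp ℂ 2 μ, InXlt μ k r ∧
        V f0 = ((goldphi : ℂ) ^ (k + 1))⁻¹ • f0 + ((goldphi : ℂ) ^ k)⁻¹ • f1 + r) ∧
      (∃ r : Lp ℂ 2 μ, InXlt μ k r ∧
        V f1 = ((goldphi : ℂ) ^ (k + 2))⁻¹ • f0 + r)) ∧
    (∀ z : ℂ,
      (∃ f : Lp ℂ 2 μ, (∃ n : ℕ, InXlt μ n f) ∧ f ≠ 0 ∧ V f = z • f) ↔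
      (∃ n : ℕ, z = ((goldphi : ℂ) ^ n)⁻¹ ∨ z = -((goldphi : ℂ) ^ (n + 2))⁻¹)) ∧
    (∀ (z : ℂ) (f g : Lp ℂ 2 μ),
      (∃ n : ℕ, InXlt μ n f) → f ≠ 0 → V f = z • f →
      (∃ n : ℕ, InXlt μ n g) → V g = z • g →
      ∃ c : ℂ, g = c • f) := by
  subst hV
  have hT := hμ.adjoint_sub_mem_initialSpan hU
  simp only [inXlt_iff, ← initialSpan_blockEigenvector]
  refine ⟨fun n f hf => map_mem_initialSpan hT _ hf, fun k f0 f1 h0 h1 => ?_, fun z => ⟨?_, ?_⟩, ?_⟩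
  · obtain rfl : f0 = blockVec μ 0 k := Lp.ext (h0.trans (coeFn_blockVec μ 0 k).symm)
    obtain rfl : f1 = blockVec μ 1 k := Lp.ext (h1.trans (coeFn_blockVec μ 1 k).symm)
    refine ⟨⟨0, Submodule.zero_mem _, by rw [add_zero, hμ.adjoint_blockVec_zero hU]⟩, ?_⟩
    rw [initialSpan_blockEigenvector]
    exact hμ.adjoint_blockVec_one hU k
  · rintro ⟨f, ⟨n, hf⟩, hf0, hfz⟩
    obtain ⟨i, -, rfl⟩ := exists_diag_eq_of_map_eq_smul hT _ hf hf0 hfz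
    obtain ⟨a, rfl | rfl⟩ := i.even_or_odd'
    · exact ⟨a, Or.inl (blockEigenvalue_even a)⟩
    · exact ⟨a, Or.inr (blockEigenvalue_odd a)⟩
  · rintro ⟨n, h⟩
    obtain ⟨m, rfl⟩ : ∃ m, z = blockEigenvalue m := by
      rcases h with rfl | rfl
      · exact ⟨2 * n, (blockEigenvalue_even n).symm⟩
      · exact ⟨2 * n + 1, (blockEigenvalue_odd n).symm⟩
    obtain ⟨f, hf, hf0, hfz⟩ := hμ.exists_eigenvector hU m
    rw [← initialSpan_blockEigenvector] at hf
    exact ⟨f, ⟨_, hf⟩, hf0, hfz⟩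
  · rintro z f g ⟨n, hf⟩ hf0 hfz ⟨n', hg⟩ hgz
    exact exists_eq_smul_of_map_eq_smul hT blockEigenvalue_injective (max (2 * n) (2 * n'))
      (initialSpan_mono _ (le_max_left _ _) hf) hf0 hfz
      (initialSpan_mono _ (le_max_right _ _) hg) hgz
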